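/- arXiv:0907.2676 — 3 statements merged into one kernel-verified Lean document; each statement's English description precedes it below -/
import Mathlib

section
/- A sequence u = (u_k)_{k≥1} ∈ A^ω is T-admissible if and only if for every k ≥ 1 the value .u_k u_{k+1}⋯ = Σ_{i≥0} u_{k+i} β^{−1−i} lies in X_{u_k}. -/
noncomputable section

/-- A bounded digit sequence has a convergent expansion in any base `β > 1`. -/
theorem summable_digits_div_pow {β : ℝ} (hβ : 1 < β) {u : ℕ → ℝ} {M : ℝ}
    (hu : ∀ k, |u k| ≤ M) (k : ℕ) : Summable fun i : ℕ => u (k + i) / β ^ (i + 1) := by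
  have hβ0 : 0 < β := by linarith
  have hgeom : Summable fun i : ℕ => M / β * (β⁻¹) ^ i :=
    (summable_geometric_of_lt_one (by positivity) (inv_lt_one_of_one_lt₀ hβ)).mul_left _
  refine hgeom.of_norm_bounded fun i => ?_
  rw [Real.norm_eq_abs, abs_div, abs_of_pos (pow_pos hβ0 _)]
  calc |u (k + i)| / β ^ (i + 1) ≤ M / β ^ (i + 1) := by gcongr; exact hu _
    _ = M / β * (β⁻¹) ^ i := by rw [inv_pow]; field_simp; ring

/-- Shifting an expansion by one digit acts on its value by `y ↦ β y - u k`. -/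
theorem tsum_digits_succ {β : ℝ} (hβ : 0 < β) {u : ℕ → ℝ} {k : ℕ}
    (hs : Summable fun i : ℕ => u (k + i) / β ^ (i + 1)) :
    ∑' i : ℕ, u (k + 1 + i) / β ^ (i + 1)
      = β * (∑' i : ℕ, u (k + i) / β ^ (i + 1)) - u k := by
  rw [hs.tsum_eq_zero_add, mul_add, ← tsum_mul_left]
  have hterm : ∀ i : ℕ, β * (u (k + (i + 1)) / β ^ (i + 1 + 1))
      = u (k + 1 + i) / β ^ (i + 1) := by
    intro i
    rw [show k + (i + 1) = k + 1 + i by ring, pow_succ β (i + 1)]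
    field_simp
  simp only [hterm, add_zero, zero_add, pow_one]
  field_simp
  ring

/-- A bounded orbit of `y ↦ β y - u k` consists of the values of the shifted expansions. -/
theorem eq_tsum_digits_of_bounded {β : ℝ} (hβ : 1 < β) {u y : ℕ → ℝ} {C : ℝ}
    (hy : ∀ k, |y k| ≤ C) (hstep : ∀ k, y (k + 1) = β * y k - u k) {k : ℕ}
    (hs : Summable fun i : ℕ => u (k + i) / β ^ (i + 1)) :
    ∑' i : ℕ, u (k + i) / β ^ (i + 1) = y k := by
  have hβ0 : 0 < β := by linarith
  have hpartial : ∀ n : ℕ, ∑ i ∈ Finset.range n, u (k + i) / β ^ (i + 1)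
      = y k - y (k + n) * (β⁻¹) ^ n := by
    intro n
    induction n with
    | zero => simp
    | succ n ih =>
      rw [Finset.sum_range_succ, ih, ← add_assoc, hstep, inv_pow, inv_pow]
      field_simp
      ring
  have hrem : Filter.Tendsto (fun n : ℕ => y (k + n) * (β⁻¹) ^ n) Filter.atTop (nhds 0) := by
    have hpow : Filter.Tendsto (fun n : ℕ => C * (β⁻¹) ^ n) Filter.atTop (nhds 0) := by
      simpa using (tendsto_pow_atTop_nhds_zero_of_lt_one (by positivity)
        (inv_lt_one_of_one_lt₀ hβ)).const_mul C
    refine squeeze_zero_norm (fun n => ?_) hpow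
    rw [Real.norm_eq_abs, abs_mul, abs_of_pos (pow_pos (inv_pos.mpr hβ0) n)]
    gcongr
    exact hy _
  refine tendsto_nhds_unique hs.hasSum.tendsto_sum_nat ?_
  simp only [hpartial]
  simpa using hrem.const_sub (y k)

/-- A sequence `u ∈ A^ω` is `T`-admissible if and only if for every `k`
the value `.u_k u_{k+1}⋯ = Σ_{i≥0} u_{k+i} β^{−1−i}` lies in `X_{u_k}`. -/
theorem statement0
    (β : ℝ) (hβ : 1 < β)
    (A : Finset ℝ)
    (Xa : ℝ → Set ℝ)
    (hXane : ∀ a ∈ A, (Xa a).Nonempty)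
    (hXabdd : ∀ a ∈ A, Bornology.IsBounded (Xa a))
    (hdisj : ∀ a ∈ A, ∀ a' ∈ A, a ≠ a' → Disjoint (Xa a) (Xa a'))
    (T : ℝ → ℝ)
    (hT : ∀ a ∈ A, ∀ x ∈ Xa a, T x = β * x - a)
    (hTmem : ∀ a ∈ A, ∀ x ∈ Xa a, T x ∈ (⋃ a' ∈ A, Xa a'))
    (b : ℝ → ℕ → ℝ)
    (hb : ∀ x ∈ (⋃ a ∈ A, Xa a), ∀ k : ℕ, b x k ∈ A ∧ T^[k] x ∈ Xa (b x k))
    (u : ℕ → ℝ) (hu : ∀ k, u k ∈ A) :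
    (∃ x ∈ (⋃ a ∈ A, Xa a), u = b x) ↔
      ∀ k : ℕ, (∑' i : ℕ, u (k + i) / β ^ (i + 1)) ∈ Xa (u k) := by
  have hβ0 : 0 < β := by linarith
  obtain ⟨M, hM⟩ := A.finite_toSet.isBounded.exists_norm_le
  have hs := summable_digits_div_pow hβ (u := u) (fun k => hM _ (hu k))
  constructor
  · rintro ⟨x, hx, rfl⟩ k
    obtain ⟨C, hC⟩ := ((Bornology.isBounded_biUnion_finset A).mpr hXabdd).exists_norm_le
    have hval := eq_tsum_digits_of_bounded (y := fun k => T^[k] x) hβ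
      (fun k => hC _ (Set.mem_biUnion (hb x hx k).1 (hb x hx k).2))
      (fun k => by
        rw [Function.iterate_succ_apply']
        exact hT _ (hb x hx k).1 _ (hb x hx k).2) (hs k)
    rw [hval]
    exact (hb x hx k).2
  · intro h
    have hx := Set.mem_biUnion (s := (A : Set ℝ)) (t := Xa) (hu 0) (h 0)
    refine ⟨_, hx, ?_⟩
    have hiter : ∀ k : ℕ, T^[k] (∑' i : ℕ, u (0 + i) / β ^ (i + 1))
        = ∑' i : ℕ, u (k + i) / β ^ (i + 1) := by
      intro k
      induction k with
      | zero => rfl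
      | succ k ih =>
        rw [Function.iterate_succ_apply', ih, hT _ (hu k) _ (h k), tsum_digits_succ hβ0 (hs k)]
    funext k
    by_contra hne
    obtain ⟨hbA, hbX⟩ := hb _ hx k
    rw [hiter k] at hbX
    exact Set.disjoint_left.mp (hdisj _ (hu k) _ hbA hne) (h k) hbX


end
end

section
/- Assume in addition that sup X_a ≤ inf X_{a'} whenever a < a' in A. Then for all x, y ∈ X one has x < y if and only if b(x) ≺ b(y) in the lexicographical order. -/
noncomputable section

/-- Strict lexicographic order on sequences of reals. -/
def LexLt (u v : ℕ → ℝ) : Prop := ∃ k, (∀ i < k, u i = v i) ∧ u k < v k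

/-- While the digits of two points agree, `T` expands their difference by exactly `β`. -/
theorem iterate_sub_iterate_of_digits_eq {β : ℝ} {A : Finset ℝ} {Xa : ℝ → Set ℝ} {T : ℝ → ℝ}
    (hT : ∀ a ∈ A, ∀ x ∈ Xa a, T x = β * x - a) {u v : ℕ → ℝ} {x y : ℝ}
    (hu : ∀ k, u k ∈ A ∧ T^[k] x ∈ Xa (u k)) (hv : ∀ k, v k ∈ A ∧ T^[k] y ∈ Xa (v k)) (k : ℕ)
    (huv : ∀ i < k, u i = v i) : T^[k] y - T^[k] x = β ^ k * (y - x) := by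
  induction k with
  | zero => simp
  | succ k ih =>
    have ih := ih fun i hi => huv i (by omega)
    rw [Function.iterate_succ_apply', Function.iterate_succ_apply',
      hT _ (hu k).1 _ (hu k).2, hT _ (hv k).1 _ (hv k).2, huv k (by omega), pow_succ]
    linear_combination β * ih

theorem lt_of_lexLt_digits {β : ℝ} (hβ : 0 < β) {A : Finset ℝ} {Xa : ℝ → Set ℝ}
    (hdisj : ∀ a ∈ A, ∀ a' ∈ A, a ≠ a' → Disjoint (Xa a) (Xa a'))
    (hmono : ∀ a ∈ A, ∀ a' ∈ A, a < a' → ∀ x ∈ Xa a, ∀ y ∈ Xa a', x ≤ y) {T : ℝ → ℝ}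
    (hT : ∀ a ∈ A, ∀ x ∈ Xa a, T x = β * x - a) {u v : ℕ → ℝ} {x y : ℝ}
    (hu : ∀ k, u k ∈ A ∧ T^[k] x ∈ Xa (u k)) (hv : ∀ k, v k ∈ A ∧ T^[k] y ∈ Xa (v k))
    (h : LexLt u v) : x < y := by
  obtain ⟨k, hk, hlt⟩ := h
  have hle := hmono _ (hu k).1 _ (hv k).1 hlt _ (hu k).2 _ (hv k).2
  have hne : T^[k] x ≠ T^[k] y :=
    (hdisj _ (hu k).1 _ (hv k).1 hlt.ne).ne_of_mem (hu k).2 (hv k).2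
  have hpos : 0 < β ^ k * (y - x) := by
    rw [← iterate_sub_iterate_of_digits_eq hT hu hv k hk]
    exact sub_pos.2 (hle.lt_of_ne hne)
  exact sub_pos.1 (pos_of_mul_pos_right hpos (pow_pos hβ k).le)

/-- Distinct points of a bounded set have distinct digit sequences. -/
theorem exists_digit_ne_of_lt {β : ℝ} (hβ : 1 < β) {A : Finset ℝ} {Xa : ℝ → Set ℝ}
    (hXabdd : ∀ a ∈ A, Bornology.IsBounded (Xa a)) {T : ℝ → ℝ}
    (hT : ∀ a ∈ A, ∀ x ∈ Xa a, T x = β * x - a) {u v : ℕ → ℝ} {x y : ℝ}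
    (hu : ∀ k, u k ∈ A ∧ T^[k] x ∈ Xa (u k)) (hv : ∀ k, v k ∈ A ∧ T^[k] y ∈ Xa (v k))
    (hxy : x < y) : ∃ k, u k ≠ v k := by
  by_contra! h
  have hbdd : Bornology.IsBounded (⋃ a ∈ A, Xa a) :=
    (Bornology.isBounded_biUnion_finset A).2 hXabdd
  obtain ⟨C, hC⟩ := Metric.isBounded_iff.1 hbdd
  obtain ⟨k, hk⟩ := pow_unbounded_of_one_lt (C / (y - x)) hβ
  have hdist := hC (Set.mem_biUnion (hv k).1 (hv k).2) (Set.mem_biUnion (hu k).1 (hu k).2)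
  rw [Real.dist_eq, iterate_sub_iterate_of_digits_eq hT hu hv k fun i _ => h i] at hdist
  rw [div_lt_iff₀ (sub_pos.2 hxy)] at hk
  exact absurd ((le_abs_self _).trans hdist) hk.not_ge

/-- If `sup X_a ≤ inf X_{a'}` whenever `a < a'`, then for `x, y ∈ X`
one has `x < y` if and only if `b(x) ≺ b(y)` lexicographically. -/
theorem statement1
    (β : ℝ) (hβ : 1 < β)
    (A : Finset ℝ)
    (Xa : ℝ → Set ℝ)
    (hXane : ∀ a ∈ A, (Xa a).Nonempty)
    (hXabdd : ∀ a ∈ A, Bornology.IsBounded (Xa a))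
    (hdisj : ∀ a ∈ A, ∀ a' ∈ A, a ≠ a' → Disjoint (Xa a) (Xa a'))
    (hmono : ∀ a ∈ A, ∀ a' ∈ A, a < a' → ∀ x ∈ Xa a, ∀ y ∈ Xa a', x ≤ y)
    (T : ℝ → ℝ)
    (hT : ∀ a ∈ A, ∀ x ∈ Xa a, T x = β * x - a)
    (hTmem : ∀ a ∈ A, ∀ x ∈ Xa a, T x ∈ (⋃ a' ∈ A, Xa a'))
    (b : ℝ → ℕ → ℝ)
    (hb : ∀ x ∈ (⋃ a ∈ A, Xa a), ∀ k : ℕ, b x k ∈ A ∧ T^[k] x ∈ Xa (b x k)) :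
    ∀ x ∈ (⋃ a ∈ A, Xa a), ∀ y ∈ (⋃ a ∈ A, Xa a), (x < y ↔ LexLt (b x) (b y)) := by
  intro x hx y hy
  refine ⟨fun hxy => ?_, lt_of_lexLt_digits (by linarith) hdisj hmono hT (hb x hx) (hb y hy)⟩
  classical
  have hex := exists_digit_ne_of_lt hβ hXabdd hT (hb x hx) (hb y hy) hxy
  have hmin : ∀ i < Nat.find hex, b x i = b y i := fun i hi => not_not.1 (Nat.find_min hex hi)
  rcases (Nat.find_spec hex).lt_or_gt with hlt | hgt
  · exact ⟨_, hmin, hlt⟩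
  · exact absurd (lt_of_lexLt_digits (by linarith) hdisj hmono hT (hb y hy) (hb x hx)
      ⟨_, fun i hi => (hmin i hi).symm, hgt⟩) hxy.not_gt

end
end

section
/- A sequence u = (u_k)_{k≥1} ∈ A^ω is T-admissible if and only if b(ℓ_{u_k}) ≼ u_k u_{k+1}⋯ ≺ b̃(r_{u_k}) for all k ≥ 1, and u is T̃-admissible if and only if b(ℓ_{u_k}) ≺ u_k u_{k+1}⋯ ≼ b̃(r_{u_k}) for all k ≥ 1. -/
noncomputable section

/-- Weak lexicographic order on sequences of reals. -/
def LexLe (u v : ℕ → ℝ) : Prop := LexLt u v ∨ u = v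

/-- `p` is the orbit under `x ↦ β * x - digit` that reads the digit sequence `u`. -/
def IsDigitOrbit (β : ℝ) (u p : ℕ → ℝ) : Prop := ∀ k, p (k + 1) = β * p k - u k

namespace IsDigitOrbit

variable {β : ℝ} {u v p q : ℕ → ℝ}

lemma shift (hp : IsDigitOrbit β u p) (k : ℕ) :
    IsDigitOrbit β (fun i => u (k + i)) (fun i => p (k + i)) := fun i => hp (k + i)

lemma sub_eq_pow_mul (hp : IsDigitOrbit β u p) (hq : IsDigitOrbit β v q) {n : ℕ}
    (h : ∀ i < n, u i = v i) : p n - q n = β ^ n * (p 0 - q 0) := by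
  induction n with
  | zero => simp
  | succ n ih =>
    have := ih fun i hi => h i (by omega)
    rw [hp n, hq n, h n (by omega), pow_succ', mul_assoc, ← this]
    ring

lemma zero_eq_of_bounded (hβ : 1 < β) (hp : IsDigitOrbit β u p) (hq : IsDigitOrbit β u q)
    {C D : ℝ} (hC : ∀ k, |p k| ≤ C) (hD : ∀ k, |q k| ≤ D) : p 0 = q 0 := by
  by_contra hne
  have hpos : 0 < |p 0 - q 0| := abs_pos.mpr (sub_ne_zero.mpr hne)
  obtain ⟨n, hn⟩ := pow_unbounded_of_one_lt ((C + D) / |p 0 - q 0|) hβ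
  rw [div_lt_iff₀ hpos] at hn
  have h := hp.sub_eq_pow_mul hq (n := n) fun _ _ => rfl
  have h' : |p n - q n| = β ^ n * |p 0 - q 0| := by
    rw [h, abs_mul, abs_of_pos (by positivity)]
  have := abs_sub (p n) (q n)
  linarith [hC n, hD n]

lemma lexLt_of_lt (hβ : 1 < β) (hp : IsDigitOrbit β u p) (hq : IsDigitOrbit β v q)
    {C D : ℝ} (hC : ∀ k, |p k| ≤ C) (hD : ∀ k, |q k| ≤ D) (h0 : p 0 < q 0)
    (hmono : ∀ n, p n < q n → u n ≤ v n) : LexLt u v := by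
  have hne : ∃ n, u n ≠ v n := by
    by_contra! hall
    obtain rfl : u = v := funext hall
    exact h0.ne (hp.zero_eq_of_bounded hβ hq hC hD)
  classical
  have heq : ∀ i < Nat.find hne, u i = v i := fun i hi => not_not.mp (Nat.find_min hne hi)
  refine ⟨Nat.find hne, heq, lt_of_le_of_ne (hmono _ ?_) (Nat.find_spec hne)⟩
  have h := hp.sub_eq_pow_mul hq heq
  have : 0 < β ^ Nat.find hne := by positivity
  nlinarith

end IsDigitOrbit

lemma exists_bounded_digitOrbit {β M : ℝ} (hβ : 1 < β) {u : ℕ → ℝ} (hu : ∀ k, |u k| ≤ M) :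
    ∃ p, IsDigitOrbit β u p ∧ ∃ C, ∀ k, |p k| ≤ C := by
  have hβ0 : β ≠ 0 := by positivity
  have hgeo : Summable fun i : ℕ => M * β⁻¹ ^ (i + 1) :=
    ((summable_nat_add_iff 1).mpr
      (summable_geometric_of_lt_one (by positivity) (inv_lt_one_of_one_lt₀ hβ))).mul_left M
  have hle : ∀ k i : ℕ, ‖u (k + i) * β⁻¹ ^ (i + 1)‖ ≤ M * β⁻¹ ^ (i + 1) := fun k i => by
    have : 0 < β⁻¹ ^ (i + 1) := by positivity
    rw [Real.norm_eq_abs, abs_mul, abs_of_pos this]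
    exact mul_le_mul_of_nonneg_right (hu _) this.le
  have hsum : ∀ k, Summable fun i : ℕ => u (k + i) * β⁻¹ ^ (i + 1) := fun k =>
    Summable.of_norm_bounded hgeo (hle k)
  refine ⟨fun k => ∑' i : ℕ, u (k + i) * β⁻¹ ^ (i + 1), fun k => ?_, _,
    fun k => tsum_of_norm_bounded hgeo.hasSum (hle k)⟩
  have hterm : ∀ i : ℕ, u (k + (i + 1)) * β⁻¹ ^ (i + 1 + 1) =
      β⁻¹ * (u (k + 1 + i) * β⁻¹ ^ (i + 1)) := fun i => by
    rw [show k + (i + 1) = k + 1 + i by ring]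
    ring
  dsimp only
  rw [(hsum k).tsum_eq_zero_add]
  simp_rw [hterm]
  rw [tsum_mul_left, mul_add, mul_inv_cancel_left₀ hβ0, zero_add, pow_one, add_zero,
    mul_comm (u k), mul_inv_cancel_left₀ hβ0, add_sub_cancel_left]

lemma nonneg_of_expanding {β C : ℝ} (hβ : 1 < β) {c : ℕ → ℝ} (hC : ∀ k, -C ≤ c k)
    (hstep : ∀ k, c k = 0 ∨ ∃ n, 1 ≤ n ∧ c (k + n) < β ^ n * c k) (k : ℕ) : 0 ≤ c k := by
  by_contra! hk
  have hiter : ∀ m : ℕ, ∃ j, c j ≤ β ^ m * c k := by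
    intro m
    induction m with
    | zero => exact ⟨k, by simp⟩
    | succ m ih =>
      obtain ⟨j, hj⟩ := ih
      have hneg : c j < 0 := hj.trans_lt (mul_neg_of_pos_of_neg (by positivity) hk)
      obtain h | ⟨n, hn, h⟩ := hstep j
      · exact absurd h hneg.ne
      · refine ⟨j + n, ?_⟩
        have hpow : β ≤ β ^ n := le_self_pow₀ hβ.le (by omega)
        rw [pow_succ']
        nlinarith
  obtain ⟨m, hm⟩ := pow_unbounded_of_one_lt (C / -c k) hβ
  rw [div_lt_iff₀ (by linarith)] at hm
  obtain ⟨j, hj⟩ := hiter m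
  linarith [hC j]

section Expansion

variable {β : ℝ} {A : Finset ℝ} {l r : ℝ → ℝ}

lemma digit_le_of_lt (horder : ∀ a ∈ A, ∀ a' ∈ A, a < a' → r a ≤ l a') {a a' x y : ℝ}
    (ha : a ∈ A) (ha' : a' ∈ A) (hx : l a ≤ x) (hy : y ≤ r a') (hxy : x < y) : a ≤ a' := by
  by_contra! h
  linarith [horder a' ha' a ha h]

lemma digit_eq_of_mem_Ico (horder : ∀ a ∈ A, ∀ a' ∈ A, a < a' → r a ≤ l a') {a a' x : ℝ}
    (ha : a ∈ A) (ha' : a' ∈ A) (hx : x ∈ Set.Ico (l a) (r a))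
    (hx' : x ∈ Set.Ico (l a') (r a')) : a = a' := by
  obtain h | h | h := lt_trichotomy a a'
  · linarith [horder a ha a' ha' h, hx.2, hx'.1]
  · exact h
  · linarith [horder a' ha' a ha h, hx.1, hx'.2]

lemma digit_eq_of_mem_Ioc (horder : ∀ a ∈ A, ∀ a' ∈ A, a < a' → r a ≤ l a') {a a' x : ℝ}
    (ha : a ∈ A) (ha' : a' ∈ A) (hx : x ∈ Set.Ioc (l a) (r a))
    (hx' : x ∈ Set.Ioc (l a') (r a')) : a = a' := by
  obtain h | h | h := lt_trichotomy a a'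
  · linarith [horder a ha a' ha' h, hx.2, hx'.1]
  · exact h
  · linarith [horder a' ha' a ha h, hx.1, hx'.2]

lemma isDigitOrbit_iterate {T : ℝ → ℝ} {X : ℝ → Set ℝ}
    (hT : ∀ a ∈ A, ∀ x ∈ X a, T x = β * x - a) {x : ℝ} {w : ℕ → ℝ}
    (hw : ∀ k, w k ∈ A ∧ T^[k] x ∈ X (w k)) : IsDigitOrbit β w fun k => T^[k] x := fun k => by
  simp only [Function.iterate_succ_apply']
  exact hT _ (hw k).1 _ (hw k).2

lemma iterate_eq_digitOrbit {T : ℝ → ℝ} {X : ℝ → Set ℝ}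
    (hT : ∀ a ∈ A, ∀ x ∈ X a, T x = β * x - a) {u p : ℕ → ℝ} (hu : ∀ k, u k ∈ A)
    (hp : IsDigitOrbit β u p) (hX : ∀ k, p k ∈ X (u k)) (k : ℕ) : T^[k] (p 0) = p k := by
  induction k with
  | zero => rfl
  | succ k ih => rw [Function.iterate_succ_apply', ih, hT _ (hu k) _ (hX k), hp k]

lemma exists_abs_le_of_mem_Icc (A : Finset ℝ) (l r : ℝ → ℝ) :
    ∃ C, ∀ a ∈ A, |a| ≤ C ∧ ∀ x ∈ Set.Icc (l a) (r a), |x| ≤ C := by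
  refine ⟨∑ a ∈ A, (|a| + |l a| + |r a|), fun a ha => ?_⟩
  have h := Finset.single_le_sum (f := fun a => |a| + |l a| + |r a|)
    (fun i _ => by positivity) ha
  have h0 := abs_nonneg a
  have h1 := abs_nonneg (l a)
  have h2 := abs_nonneg (r a)
  refine ⟨by linarith, fun x hx => abs_le.mpr ⟨?_, ?_⟩⟩
  · linarith [neg_abs_le (l a), hx.1]
  · linarith [le_abs_self (r a), hx.2]

variable {u p : ℕ → ℝ}

/-- A bounded orbit stays to the right of the left endpoints if its digits dominate the expansions
of these endpoints. -/
lemma left_endpoint_le (hβ : 1 < β) (horder : ∀ a ∈ A, ∀ a' ∈ A, a < a' → r a ≤ l a')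
    {C D : ℝ} (hD : ∀ a ∈ A, ∀ x ∈ Set.Icc (l a) (r a), |x| ≤ D) (hlr : ∀ a ∈ A, l a < r a)
    {w q : ℝ → ℕ → ℝ} (hq : ∀ a ∈ A, IsDigitOrbit β (w a) (q a)) (hq0 : ∀ a ∈ A, q a 0 = l a)
    (hw : ∀ a ∈ A, ∀ n, w a n ∈ A ∧ q a n ∈ Set.Ico (l (w a n)) (r (w a n)))
    (hu : ∀ k, u k ∈ A) (hp : IsDigitOrbit β u p) (hC : ∀ k, |p k| ≤ C)
    (h : ∀ k, LexLe (w (u k)) fun i => u (k + i)) (k : ℕ) :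
    l (u k) ≤ p k ∧ (LexLt (w (u k)) (fun i => u (k + i)) → l (u k) < p k) := by
  have hlt : ∀ k, LexLt (w (u k)) (fun i => u (k + i)) →
      ∃ n, 1 ≤ n ∧ p (k + n) - l (u (k + n)) < β ^ n * (p k - l (u k)) := by
    rintro k ⟨n, heq, hn⟩
    have hn0 : 1 ≤ n := by
      by_contra! h0
      obtain rfl : n = 0 := by omega
      have hmem := (hw _ (hu k) 0).2
      have hwk : w (u k) 0 = u k := digit_eq_of_mem_Ico horder (hw _ (hu k) 0).1 (hu k) hmem
        (by rw [hq0 _ (hu k)]; exact ⟨le_rfl, hlr _ (hu k)⟩)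
      simp [hwk] at hn
    refine ⟨n, hn0, ?_⟩
    have hsub := (hp.shift k).sub_eq_pow_mul (hq _ (hu k)) fun i hi => (heq i hi).symm
    rw [hq0 _ (hu k)] at hsub
    have hr := horder _ (hw _ (hu k) n).1 _ (hu (k + n)) hn
    have := (hw _ (hu k) n).2.2
    simp only [add_zero] at hsub
    linarith
  have hnonneg : ∀ k, 0 ≤ p k - l (u k) := by
    refine nonneg_of_expanding (C := C + D) hβ (fun k => ?_) fun k => ?_
    · have hl := hD _ (hu k) (l (u k)) ⟨le_rfl, (hlr _ (hu k)).le⟩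
      linarith [(abs_le.mp hl).2, (abs_le.mp (hC k)).1]
    · obtain hk | hk := h k
      · exact Or.inr (hlt k hk)
      · have hqk := hq _ (hu k)
        rw [hk] at hqk
        have h0 := (hp.shift k).zero_eq_of_bounded hβ hqk (fun i => hC (k + i))
          fun n => hD _ (hw _ (hu k) n).1 _ (Set.Ico_subset_Icc_self (hw _ (hu k) n).2)
        exact Or.inl (sub_eq_zero.mpr (h0.trans (hq0 _ (hu k))))
  refine ⟨sub_nonneg.mp (hnonneg k), fun hk => ?_⟩
  obtain ⟨n, -, hn⟩ := hlt k hk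
  exact sub_pos.mp (pos_of_mul_pos_right ((hnonneg (k + n)).trans_lt hn) (by positivity))

/-- A bounded orbit stays to the left of the right endpoints if its digits are dominated by the
expansions of these endpoints. -/
lemma le_right_endpoint (hβ : 1 < β) (horder : ∀ a ∈ A, ∀ a' ∈ A, a < a' → r a ≤ l a')
    {C D : ℝ} (hD : ∀ a ∈ A, ∀ x ∈ Set.Icc (l a) (r a), |x| ≤ D) (hlr : ∀ a ∈ A, l a < r a)
    {w q : ℝ → ℕ → ℝ} (hq : ∀ a ∈ A, IsDigitOrbit β (w a) (q a)) (hq0 : ∀ a ∈ A, q a 0 = r a)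
    (hw : ∀ a ∈ A, ∀ n, w a n ∈ A ∧ q a n ∈ Set.Ioc (l (w a n)) (r (w a n)))
    (hu : ∀ k, u k ∈ A) (hp : IsDigitOrbit β u p) (hC : ∀ k, |p k| ≤ C)
    (h : ∀ k, LexLe (fun i => u (k + i)) (w (u k))) (k : ℕ) :
    p k ≤ r (u k) ∧ (LexLt (fun i => u (k + i)) (w (u k)) → p k < r (u k)) := by
  have hlt : ∀ k, LexLt (fun i => u (k + i)) (w (u k)) →
      ∃ n, 1 ≤ n ∧ r (u (k + n)) - p (k + n) < β ^ n * (r (u k) - p k) := by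
    rintro k ⟨n, heq, hn⟩
    have hn0 : 1 ≤ n := by
      by_contra! h0
      obtain rfl : n = 0 := by omega
      have hmem := (hw _ (hu k) 0).2
      have hwk : w (u k) 0 = u k := digit_eq_of_mem_Ioc horder (hw _ (hu k) 0).1 (hu k) hmem
        (by rw [hq0 _ (hu k)]; exact ⟨hlr _ (hu k), le_rfl⟩)
      simp [hwk] at hn
    refine ⟨n, hn0, ?_⟩
    have hsub := (hq _ (hu k)).sub_eq_pow_mul (hp.shift k) fun i hi => (heq i hi).symm
    rw [hq0 _ (hu k)] at hsub
    have hr := horder _ (hu (k + n)) _ (hw _ (hu k) n).1 hn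
    have := (hw _ (hu k) n).2.1
    simp only [add_zero] at hsub
    linarith
  have hnonneg : ∀ k, 0 ≤ r (u k) - p k := by
    refine nonneg_of_expanding (C := C + D) hβ (fun k => ?_) fun k => ?_
    · have hl := hD _ (hu k) (r (u k)) ⟨(hlr _ (hu k)).le, le_rfl⟩
      linarith [(abs_le.mp hl).1, (abs_le.mp (hC k)).2]
    · obtain hk | hk := h k
      · exact Or.inr (hlt k hk)
      · have hqk := hq _ (hu k)
        rw [← hk] at hqk
        have h0 := hqk.zero_eq_of_bounded hβ (hp.shift k)
          (fun n => hD _ (hw _ (hu k) n).1 _ (Set.Ioc_subset_Icc_self (hw _ (hu k) n).2))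
          (fun i => hC (k + i))
        exact Or.inl (sub_eq_zero.mpr ((hq0 _ (hu k)).symm.trans h0))
  refine ⟨sub_nonneg.mp (hnonneg k), fun hk => ?_⟩
  obtain ⟨n, -, hn⟩ := hlt k hk
  exact sub_pos.mp (pos_of_mul_pos_right ((hnonneg (k + n)).trans_lt hn) (by positivity))

end Expansion

/-- `u` is `T`-admissible iff `b(ℓ_{u_k}) ≼ u_k u_{k+1}⋯ ≺ b̃(r_{u_k})`
for all `k`, and `u` is `T̃`-admissible iff `b(ℓ_{u_k}) ≺ u_k u_{k+1}⋯ ≼ b̃(r_{u_k})`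
for all `k`. -/
theorem statement2
    (β : ℝ) (hβ : 1 < β)
    (A : Finset ℝ)
    (l r : ℝ → ℝ)
    (hlr : ∀ a ∈ A, l a < r a)
    (hbddX : ∀ a ∈ A, Bornology.IsBounded (Set.Ico (l a) (r a)))
    (horder : ∀ a ∈ A, ∀ a' ∈ A, a < a' → r a ≤ l a')
    (hdisj : ∀ a ∈ A, ∀ a' ∈ A, a ≠ a' → Disjoint (Set.Ico (l a) (r a)) (Set.Ico (l a') (r a')))
    (hsurj : (⋃ a ∈ A, (fun x => β * x - a) '' Set.Ico (l a) (r a)) = ⋃ a ∈ A, Set.Ico (l a) (r a))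
    (T : ℝ → ℝ) (hT : ∀ a ∈ A, ∀ x ∈ Set.Ico (l a) (r a), T x = β * x - a)
    (Tt : ℝ → ℝ) (hTt : ∀ a ∈ A, ∀ x ∈ Set.Ioc (l a) (r a), Tt x = β * x - a)
    (b : ℝ → ℕ → ℝ)
    (hb : ∀ x ∈ (⋃ a ∈ A, Set.Ico (l a) (r a)), ∀ k : ℕ,
      b x k ∈ A ∧ T^[k] x ∈ Set.Ico (l (b x k)) (r (b x k)))
    (bt : ℝ → ℕ → ℝ)
    (hbt : ∀ x ∈ (⋃ a ∈ A, Set.Ioc (l a) (r a)), ∀ k : ℕ,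
      bt x k ∈ A ∧ Tt^[k] x ∈ Set.Ioc (l (bt x k)) (r (bt x k)))
    (u : ℕ → ℝ) (hu : ∀ k, u k ∈ A) :
    ((∃ x ∈ (⋃ a ∈ A, Set.Ico (l a) (r a)), u = b x) ↔
      ∀ k : ℕ, LexLe (b (l (u k))) (fun i => u (k + i)) ∧
        LexLt (fun i => u (k + i)) (bt (r (u k))))
    ∧
    ((∃ x ∈ (⋃ a ∈ A, Set.Ioc (l a) (r a)), u = bt x) ↔
      ∀ k : ℕ, LexLt (b (l (u k))) (fun i => u (k + i)) ∧
        LexLe (fun i => u (k + i)) (bt (r (u k)))) := by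
  obtain ⟨D, hAD⟩ := exists_abs_le_of_mem_Icc A l r
  have hD : ∀ a ∈ A, ∀ x ∈ Set.Icc (l a) (r a), |x| ≤ D := fun a ha => (hAD a ha).2
  have hlmem : ∀ a ∈ A, l a ∈ ⋃ a ∈ A, Set.Ico (l a) (r a) := fun a ha =>
    Set.mem_biUnion ha ⟨le_rfl, hlr a ha⟩
  have hrmem : ∀ a ∈ A, r a ∈ ⋃ a ∈ A, Set.Ioc (l a) (r a) := fun a ha =>
    Set.mem_biUnion ha ⟨hlr a ha, le_rfl⟩
  have horb : ∀ x ∈ ⋃ a ∈ A, Set.Ico (l a) (r a), IsDigitOrbit β (b x) fun k => T^[k] x :=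
    fun x hx => isDigitOrbit_iterate hT (hb x hx)
  have horbt : ∀ x ∈ ⋃ a ∈ A, Set.Ioc (l a) (r a), IsDigitOrbit β (bt x) fun k => Tt^[k] x :=
    fun x hx => isDigitOrbit_iterate hTt (hbt x hx)
  have hmem : ∀ x ∈ ⋃ a ∈ A, Set.Ico (l a) (r a), ∀ k,
      b x k ∈ A ∧ T^[k] x ∈ Set.Icc (l (b x k)) (r (b x k)) := fun x hx k =>
    ⟨(hb x hx k).1, Set.Ico_subset_Icc_self (hb x hx k).2⟩
  have hmemt : ∀ x ∈ ⋃ a ∈ A, Set.Ioc (l a) (r a), ∀ k,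
      bt x k ∈ A ∧ Tt^[k] x ∈ Set.Icc (l (bt x k)) (r (bt x k)) := fun x hx k =>
    ⟨(hbt x hx k).1, Set.Ioc_subset_Icc_self (hbt x hx k).2⟩
  have hlex : ∀ {v p w q : ℕ → ℝ}, IsDigitOrbit β v p → IsDigitOrbit β w q →
      (∀ k, v k ∈ A ∧ p k ∈ Set.Icc (l (v k)) (r (v k))) →
      (∀ k, w k ∈ A ∧ q k ∈ Set.Icc (l (w k)) (r (w k))) → p 0 < q 0 → LexLt v w :=
    fun hp hq hv hw h0 => hp.lexLt_of_lt hβ hq (fun k => hD _ (hv k).1 _ (hv k).2)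
      (fun k => hD _ (hw k).1 _ (hw k).2) h0 fun n =>
        digit_le_of_lt horder (hv n).1 (hw n).1 (hv n).2.1 (hw n).2.2
  obtain ⟨p, hp, C, hC⟩ := exists_bounded_digitOrbit hβ fun k => (hAD _ (hu k)).1
  have hleft := fun h => left_endpoint_le hβ horder hD hlr (fun a ha => horb _ (hlmem a ha))
    (fun _ _ => rfl) (fun a ha => hb _ (hlmem a ha)) hu hp hC h
  have hright := fun h => le_right_endpoint hβ horder hD hlr (fun a ha => horbt _ (hrmem a ha))
    (fun _ _ => rfl) (fun a ha => hbt _ (hrmem a ha)) hu hp hC h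
  refine ⟨⟨?_, fun h => ?_⟩, ⟨?_, fun h => ?_⟩⟩
  · rintro ⟨x, hx, rfl⟩ k
    have hsh := (horb x hx).shift k
    have hshmem := fun i => hmem x hx (k + i)
    refine ⟨?_, hlex hsh (horbt _ (hrmem _ (hu k))) hshmem (hmemt _ (hrmem _ (hu k)))
      (hb x hx k).2.2⟩
    obtain hlt | heq := (hb x hx k).2.1.lt_or_eq
    · exact Or.inl (hlex (horb _ (hlmem _ (hu k))) hsh (hmem _ (hlmem _ (hu k))) hshmem hlt)
    · refine Or.inr (funext fun i => digit_eq_of_mem_Ico horder (hb _ (hlmem _ (hu k)) i).1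
        (hu (k + i)) (hb _ (hlmem _ (hu k)) i).2 ?_)
      have := (hb x hx (k + i)).2
      rwa [add_comm, Function.iterate_add_apply, ← heq, add_comm] at this
  · have hX : ∀ k, p k ∈ Set.Ico (l (u k)) (r (u k)) := fun k =>
      ⟨(hleft (fun k => (h k).1) k).1, (hright (fun k => Or.inl (h k).2) k).2 (h k).2⟩
    have hx := Set.mem_biUnion (t := fun a => Set.Ico (l a) (r a)) (hu 0) (hX 0)
    refine ⟨p 0, hx, funext fun k =>
      digit_eq_of_mem_Ico horder (hu k) (hb _ hx k).1 (hX k) ?_⟩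
    rw [← iterate_eq_digitOrbit hT hu hp hX k]
    exact (hb _ hx k).2
  · rintro ⟨x, hx, rfl⟩ k
    have hsh := (horbt x hx).shift k
    have hshmem := fun i => hmemt x hx (k + i)
    refine ⟨hlex (horb _ (hlmem _ (hu k))) hsh (hmem _ (hlmem _ (hu k))) hshmem
      (hbt x hx k).2.1, ?_⟩
    obtain hlt | heq := (hbt x hx k).2.2.lt_or_eq
    · exact Or.inl (hlex hsh (horbt _ (hrmem _ (hu k))) hshmem (hmemt _ (hrmem _ (hu k))) hlt)
    · refine Or.inr (funext fun i => digit_eq_of_mem_Ioc horder (hu (k + i))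
        (hbt _ (hrmem _ (hu k)) i).1 ?_ (hbt _ (hrmem _ (hu k)) i).2)
      have := (hbt x hx (k + i)).2
      rwa [add_comm, Function.iterate_add_apply, heq, add_comm] at this
  · have hX : ∀ k, p k ∈ Set.Ioc (l (u k)) (r (u k)) := fun k =>
      ⟨(hleft (fun k => Or.inl (h k).1) k).2 (h k).1, (hright (fun k => (h k).2) k).1⟩
    have hx := Set.mem_biUnion (t := fun a => Set.Ioc (l a) (r a)) (hu 0) (hX 0)
    refine ⟨p 0, hx, funext fun k =>
      digit_eq_of_mem_Ioc horder (hu k) (hbt _ hx k).1 (hX k) ?_⟩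
    rw [← iterate_eq_digitOrbit hTt hu hp hX k]
    exact (hbt _ hx k).2

end
end
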